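/- Let w_1,…,w_ℓ ∈ F_r and suppose that for some index i ∈ {1,…,r} the total exponent of the i-th generator, summed over all the words w_1,…,w_ℓ, is nonzero (i.e. Σ_{j=1}^ℓ τ_i(w_j) ≠ 0, where τ_i : F_r → ℤ is the homomorphism sending the i-th generator to 1 and all other generators to 0). Then for every n ≥ 1: ∫_{U(n)^r} ∏_{j=1}^ℓ tr(w_j(g_1,…,g_r)) dg_1⋯dg_r = 0. -/

import Mathlib

open MeasureTheory

/-- The unitary group `U(n)` of `n × n` complex unitary matrices. -/
abbrev UG (n : ℕ) := Matrix.unitaryGroup (Fin n) ℂ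

noncomputable instance (n : ℕ) : MeasurableSpace (UG n) := borel _

instance (n : ℕ) : BorelSpace (UG n) := ⟨rfl⟩

/-- The class function `ξ_m : A ↦ tr (A^m)` on `U(n)`. -/
noncomputable def xi (n : ℕ) (m : ℤ) (A : UG n) : ℂ :=
  Matrix.trace ((A ^ m : UG n) : Matrix (Fin n) (Fin n) ℂ)

/-- `E_w[φ](n) = ∫_{U(n)^r} φ(w(g₁,…,g_r)) dg₁⋯dg_r`, the expected value of `φ n` under
the word measure of `w`, where `μ n` is the (Haar probability) measure on `U(n)`. -/
noncomputable def wordExpectation {r : ℕ} (μ : (n : ℕ) → Measure (UG n))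
    (w : FreeGroup (Fin r)) (φ : (n : ℕ) → UG n → ℂ) (n : ℕ) : ℂ :=
  ∫ g : Fin r → UG n, φ n (FreeGroup.lift g w) ∂(Measure.pi fun _ => μ n)

/-- The inner product `⟨f, g⟩ = ∫ f · conj g dμ` of two functions on `U(n)`. -/
noncomputable def innerU {n : ℕ} (μ : Measure (UG n)) (f g : UG n → ℂ) : ℂ :=
  ∫ A, f A * (starRingEnd ℂ) (g A) ∂μ

/-- The total exponent of the `i`-th generator in a word, as a homomorphism to `ℤ`. -/
noncomputable def totalExp {r : ℕ} (i : Fin r) : FreeGroup (Fin r) →* Multiplicative ℤ :=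
  FreeGroup.lift fun j => Multiplicative.ofAdd (if j = i then (1 : ℤ) else 0)

/-- The scalar embedding of the circle into `U(n)`. -/
noncomputable def scalarHom (n : ℕ) : Circle →* UG n where
  toFun z := ⟨(z : ℂ) • (1 : Matrix (Fin n) (Fin n) ℂ), by
    rw [Matrix.mem_unitaryGroup_iff, star_smul, star_one, smul_mul_smul_comm, mul_one]
    have hz : (z : ℂ) * star (z : ℂ) = 1 := by
      have := Complex.mul_conj (z : ℂ)
      rw [Circle.normSq_coe] at this
      simpa using this
    rw [hz, one_smul]⟩
  map_one' := by ext; simp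
  map_mul' a b := by
    apply Subtype.ext
    simp [smul_smul, mul_comm]

lemma coe_scalarHom_mul {n : ℕ} (z : Circle) (A : UG n) :
    ((scalarHom n z * A : UG n) : Matrix (Fin n) (Fin n) ℂ) = (z : ℂ) • (A : Matrix _ _ ℂ) := by
  simp [scalarHom]

lemma scalarHom_comm {n : ℕ} (z : Circle) (A : UG n) :
    A * scalarHom n z = scalarHom n z * A := by
  apply Subtype.ext
  simp [scalarHom]

lemma prod_coe_zpow {ι : Type*} (z : Circle) (s : Finset ι) (e : ι → ℤ) :
    ∏ j ∈ s, ((z ^ e j : Circle) : ℂ) = ((z ^ (∑ j ∈ s, e j) : Circle) : ℂ) := by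
  classical
  induction s using Finset.induction_on with
  | empty => simp
  | insert a s ha ih =>
    rw [Finset.prod_insert ha, Finset.sum_insert ha, ih, zpow_add, Circle.coe_mul]

lemma lift_scalar_mul {r n : ℕ} (i : Fin r) (z : Circle) (g : Fin r → UG n)
    (w : FreeGroup (Fin r)) :
    FreeGroup.lift ((fun j => if j = i then scalarHom n z else 1) * g) w =
      scalarHom n (z ^ (Multiplicative.toAdd (totalExp i w))) * FreeGroup.lift g w := by
  have key : ∀ a b : FreeGroup (Fin r), ∀ f f' : FreeGroup (Fin r) →* UG n,
      f a = scalarHom n (z ^ (Multiplicative.toAdd (totalExp i a))) * f' a →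
      f b = scalarHom n (z ^ (Multiplicative.toAdd (totalExp i b))) * f' b →
      f (a * b) = scalarHom n (z ^ (Multiplicative.toAdd (totalExp i (a * b)))) * f' (a * b) := by
    intro a b f f' ha hb
    rw [map_mul, ha, hb, map_mul (totalExp i), toAdd_mul, zpow_add, map_mul (scalarHom n),
      map_mul f']
    rw [mul_assoc, mul_assoc, ← mul_assoc (f' a), scalarHom_comm, mul_assoc]
  induction w using FreeGroup.induction_on with
  | C1 => simp
  | of j =>
    by_cases hj : j = i <;> simp [totalExp, hj]
  | inv_of j hj =>
    rw [map_inv, hj, map_inv (totalExp i), toAdd_inv, zpow_neg, map_inv (scalarHom n),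
      map_inv (FreeGroup.lift g), mul_inv_rev, ← map_inv (scalarHom n), scalarHom_comm]
  | mul a b ha hb => exact key a b _ _ ha hb

/-- If the total exponent of some generator over the words `w₁, …, w_ℓ` is nonzero, the
mixed moment `∫ ∏ tr(wⱼ(g₁,…,g_r))` vanishes. -/
theorem mixed_moment_eq_zero_of_unbalanced {r ℓ n : ℕ} (ws : Fin ℓ → FreeGroup (Fin r))
    (i : Fin r) (h : (∑ j, Multiplicative.toAdd (totalExp i (ws j))) ≠ 0)
    (hn : 1 ≤ n) (μ : Measure (UG n))
    (hμ : μ.IsHaarMeasure ∧ IsProbabilityMeasure μ) :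
    ∫ g : Fin r → UG n,
        ∏ j, Matrix.trace ((FreeGroup.lift g (ws j) : UG n) : Matrix (Fin n) (Fin n) ℂ)
        ∂(Measure.pi fun _ => μ) = 0 := by
  obtain ⟨h1, h2⟩ := hμ
  set N := ∑ j, Multiplicative.toAdd (totalExp i (ws j)) with hN
  obtain ⟨z, hz⟩ : ∃ z : Circle, ((z ^ N : Circle) : ℂ) = -1 := by
    refine ⟨Circle.exp (Real.pi / N), ?_⟩
    have hN0 : (N : ℂ) ≠ 0 := by exact_mod_cast h
    rw [Circle.coe_zpow, Circle.coe_exp, ← Complex.exp_int_mul, ← Complex.exp_pi_mul_I]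
    congr 1
    push_cast
    field_simp
  set F : (Fin r → UG n) → ℂ := fun g =>
    ∏ j, Matrix.trace ((FreeGroup.lift g (ws j) : UG n) : Matrix (Fin n) (Fin n) ℂ) with hF
  have hinv := integral_mul_left_eq_self (μ := Measure.pi fun _ : Fin r => μ) F
    (fun j => if j = i then scalarHom n z else 1)
  have hpt : ∀ g, F ((fun j => if j = i then scalarHom n z else 1) * g) = -1 * F g := by
    intro g
    simp only [hF]
    rw [← hz]
    simp only [lift_scalar_mul, coe_scalarHom_mul, Matrix.trace_smul, smul_eq_mul]
    rw [Finset.prod_mul_distrib]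
    congr 1
    exact prod_coe_zpow z _ _
  simp only [hpt] at hinv
  rw [integral_const_mul] at hinv
  change ∫ g, F g ∂_ = 0
  linear_combination (-1/2 : ℂ) * hinv
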